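/- arXiv:2503.05883 — 4 statements merged into one kernel-verified Lean document; each statement's English description precedes it below -/
import Mathlib

section
/- Let Ã be a real symmetric n×n matrix and T an invertible real n×n matrix such that Tᵀ Ã T = Λ is diagonal with diagonal entries λ₁,…,λₙ; set Λ⁺ = diag(max(λᵢ,0)), |Λ⁻| = diag(max(−λᵢ,0)), A⁺ = √Λ⁺ · T⁻¹ and A⁻ = √|Λ⁻| · T⁻¹. Let R be a real n×n matrix with I − RᵀR positive semidefinite. If a vector U ∈ ℝⁿ satisfies the homogeneous boundary condition (A⁻ − R A⁺)U = 0, then the boundary term is nonnegative: Uᵀ Ã U ≥ 0. -/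
open Matrix

/-- A matrix `R` with `I − RᵀR ⪰ 0` is a contraction for the Euclidean length. -/
lemma dotProduct_mulVec_self_le_of_posSemidef {m : Type*} [Fintype m] [DecidableEq m]
    {R : Matrix m m ℝ} (hR : (1 - Rᵀ * R).PosSemidef) (p : m → ℝ) :
    R *ᵥ p ⬝ᵥ R *ᵥ p ≤ p ⬝ᵥ p := by
  have h := hR.dotProduct_mulVec_nonneg p
  rw [star_trivial, sub_mulVec, one_mulVec, dotProduct_sub, ← mulVec_mulVec,
    dotProduct_mulVec p Rᵀ, vecMul_transpose] at h
  linarith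

/-- The quadratic form of a diagonal matrix splits into its positive and negative parts. -/
lemma dotProduct_diagonal_mulVec_eq_sub {m : Type*} [Fintype m] [DecidableEq m]
    (lam W : m → ℝ) :
    W ⬝ᵥ diagonal lam *ᵥ W =
      (diagonal fun i => √(max (lam i) 0)) *ᵥ W ⬝ᵥ (diagonal fun i => √(max (lam i) 0)) *ᵥ W
      - (diagonal fun i => √(max (-lam i) 0)) *ᵥ W ⬝ᵥ
          (diagonal fun i => √(max (-lam i) 0)) *ᵥ W := by
  simp only [dotProduct, mulVec_diagonal, ← Finset.sum_sub_distrib]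
  refine Finset.sum_congr rfl fun i _ => ?_
  have hpos := Real.mul_self_sqrt (le_max_right (lam i) 0)
  have hneg := Real.mul_self_sqrt (le_max_right (-lam i) 0)
  have hsplit : max (lam i) 0 - max (-lam i) 0 = lam i := by grind
  linear_combination (-(W i) ^ 2) * (hpos - hneg + hsplit)

/-- strong homogeneous nonlinear boundary conditions give a
nonnegative boundary term when `I − RᵀR ⪰ 0`. -/
theorem strong_homogeneous_bc_nonneg (n : ℕ) (hn : 0 < n)
    (Atil T : Matrix (Fin n) (Fin n) ℝ)
    (hsym : Atil.IsSymm) (hT : IsUnit T.det)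
    (lam : Fin n → ℝ) (hdiag : Tᵀ * Atil * T = Matrix.diagonal lam)
    (R : Matrix (Fin n) (Fin n) ℝ)
    (hR : (1 - Rᵀ * R).PosSemidef)
    (U : Fin n → ℝ)
    (hBC : ((Matrix.diagonal fun i => Real.sqrt (max (-lam i) 0)) * T⁻¹
            - R * ((Matrix.diagonal fun i => Real.sqrt (max (lam i) 0)) * T⁻¹)).mulVec U
          = 0) :
    0 ≤ U ⬝ᵥ Atil.mulVec U := by
  obtain ⟨W, rfl⟩ : ∃ W, U = T *ᵥ W :=
    ⟨T⁻¹ *ᵥ U, by rw [mulVec_mulVec, mul_nonsing_inv T hT, one_mulVec]⟩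
  have hform : T *ᵥ W ⬝ᵥ Atil *ᵥ (T *ᵥ W) = W ⬝ᵥ diagonal lam *ᵥ W := by
    rw [← hdiag, ← mulVec_mulVec, ← mulVec_mulVec, dotProduct_mulVec W Tᵀ, vecMul_transpose]
  rw [sub_mulVec, sub_eq_zero, mulVec_mulVec, mulVec_mulVec, Matrix.mul_assoc, Matrix.mul_assoc,
    Matrix.mul_assoc, nonsing_inv_mul T hT, Matrix.mul_one, Matrix.mul_one,
    ← mulVec_mulVec] at hBC
  rw [hform, dotProduct_diagonal_mulVec_eq_sub, hBC]
  exact sub_nonneg.mpr (dotProduct_mulVec_self_le_of_posSemidef hR _)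
end

section
/- Let Ã be a real symmetric n×n matrix and T an invertible real n×n matrix such that Tᵀ Ã T = Λ is diagonal with diagonal entries λ₁,…,λₙ; set Λ⁺ = diag(max(λᵢ,0)), |Λ⁻| = diag(max(−λᵢ,0)), A⁺ = √Λ⁺ · T⁻¹ and A⁻ = √|Λ⁻| · T⁻¹. Let R and S be real n×n matrices such that I − RᵀR is positive definite and I − SᵀS − (RᵀS)ᵀ(I − RᵀR)⁻¹(RᵀS) is positive semidefinite. Then for every U ∈ ℝⁿ and every data vector G ∈ ℝⁿ, the boundary term obtained with the weak inhomogeneous penalty implementation is bounded by the data: Uᵀ Ã U + 2 (A⁻U)ᵀ((A⁻ − R A⁺)U − S G) ≥ −‖G‖². -/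
open Matrix

/-- Euclidean norm of a vector in `ℝⁿ`. -/
noncomputable def eNorm {n : ℕ} (v : Fin n → ℝ) : ℝ :=
  ‖(EuclideanSpace.equiv (Fin n) ℝ).symm v‖

/-- The square of the Euclidean norm is the dot product of the vector with itself. -/
theorem eNorm_sq {n : ℕ} (v : Fin n → ℝ) : eNorm v ^ 2 = v ⬝ᵥ v := by
  simp [eNorm, EuclideanSpace.real_norm_sq_eq, dotProduct, ← sq]

/-- If the Schur complement condition holds, the block row `[R S]` is a contraction. -/
theorem dotProduct_self_mulVec_add_mulVec_le {ι : Type*} [Fintype ι] [DecidableEq ι]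
    {R S : Matrix ι ι ℝ} (hR : (1 - Rᵀ * R).PosDef)
    (hS : (1 - Sᵀ * S - (Rᵀ * S)ᵀ * (1 - Rᵀ * R)⁻¹ * (Rᵀ * S)).PosSemidef) (p g : ι → ℝ) :
    (R *ᵥ p + S *ᵥ g) ⬝ᵥ (R *ᵥ p + S *ᵥ g) ≤ p ⬝ᵥ p + g ⬝ᵥ g := by
  set K := 1 - Rᵀ * R with hK
  have hKw : K *ᵥ (K⁻¹ *ᵥ ((Rᵀ * S) *ᵥ g)) = (Rᵀ * S) *ᵥ g := by
    rw [mulVec_mulVec, mul_nonsing_inv _ ((isUnit_iff_isUnit_det K).mp hR.isUnit), one_mulVec]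
  have hquad := hR.posSemidef.dotProduct_mulVec_nonneg (p - K⁻¹ *ᵥ ((Rᵀ * S) *ᵥ g))
  have hschur := hS.dotProduct_mulVec_nonneg g
  have hsymm : (K⁻¹ *ᵥ ((Rᵀ * S) *ᵥ g)) ⬝ᵥ (K *ᵥ p) = p ⬝ᵥ ((Rᵀ * S) *ᵥ g) := by
    have hKt : Kᵀ = K := by simp [hK]
    rw [dotProduct_mulVec, ← mulVec_transpose, hKt, hKw, dotProduct_comm]
  have hp : p ⬝ᵥ (K *ᵥ p) = p ⬝ᵥ p - (R *ᵥ p) ⬝ᵥ (R *ᵥ p) := by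
    rw [hK, sub_mulVec, one_mulVec, dotProduct_sub, ← mulVec_mulVec, dotProduct_mulVec p,
      vecMul_transpose]
  have hcross : p ⬝ᵥ ((Rᵀ * S) *ᵥ g) = (R *ᵥ p) ⬝ᵥ (S *ᵥ g) := by
    rw [← mulVec_mulVec, dotProduct_mulVec p, vecMul_transpose]
  have hg : g ⬝ᵥ ((Sᵀ * S) *ᵥ g) = (S *ᵥ g) ⬝ᵥ (S *ᵥ g) := by
    rw [← mulVec_mulVec, dotProduct_mulVec g, vecMul_transpose]
  have hw : g ⬝ᵥ (((Rᵀ * S)ᵀ * K⁻¹ * (Rᵀ * S)) *ᵥ g) =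
      (K⁻¹ *ᵥ ((Rᵀ * S) *ᵥ g)) ⬝ᵥ ((Rᵀ * S) *ᵥ g) := by
    rw [← mulVec_mulVec, ← mulVec_mulVec, dotProduct_mulVec g, vecMul_transpose,
      dotProduct_comm]
  rw [star_trivial, mulVec_sub, hKw, sub_dotProduct, dotProduct_sub, dotProduct_sub, hsymm, hp,
    hcross] at hquad
  rw [star_trivial, sub_mulVec, sub_mulVec, one_mulVec, dotProduct_sub, dotProduct_sub, hg, hw]
    at hschur
  simp only [add_dotProduct, dotProduct_add]
  linarith [dotProduct_comm (S *ᵥ g) (R *ᵥ p)]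

/-- A congruence diagonalization splits the quadratic form into its positive and negative parts. -/
theorem dotProduct_mulVec_eq_sub_of_congr_diagonal {ι : Type*} [Fintype ι] [DecidableEq ι]
    {A T : Matrix ι ι ℝ} (hT : IsUnit T.det) {lam : ι → ℝ}
    (hdiag : Tᵀ * A * T = diagonal lam) (u : ι → ℝ) :
    u ⬝ᵥ (A *ᵥ u) =
      ((diagonal fun i => √(max (lam i) 0)) * T⁻¹) *ᵥ u ⬝ᵥ
          ((diagonal fun i => √(max (lam i) 0)) * T⁻¹) *ᵥ u -
        ((diagonal fun i => √(max (-lam i) 0)) * T⁻¹) *ᵥ u ⬝ᵥ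
          ((diagonal fun i => √(max (-lam i) 0)) * T⁻¹) *ᵥ u := by
  simp only [← mulVec_mulVec]
  obtain ⟨w, rfl⟩ : ∃ w, u = T *ᵥ w :=
    ⟨T⁻¹ *ᵥ u, by rw [mulVec_mulVec, mul_nonsing_inv _ hT, one_mulVec]⟩
  have hw : T⁻¹ *ᵥ (T *ᵥ w) = w := by rw [mulVec_mulVec, nonsing_inv_mul _ hT, one_mulVec]
  have hquad : T *ᵥ w ⬝ᵥ (A *ᵥ (T *ᵥ w)) = w ⬝ᵥ (diagonal lam *ᵥ w) := by
    rw [← hdiag, ← mulVec_mulVec, ← mulVec_mulVec, dotProduct_mulVec w, vecMul_transpose]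
  rw [hw, hquad]
  simp only [dotProduct, mulVec_diagonal, ← Finset.sum_sub_distrib]
  refine Finset.sum_congr rfl fun i _ => ?_
  have hpos := Real.mul_self_sqrt (le_max_right (lam i) 0)
  have hneg := Real.mul_self_sqrt (le_max_right (-lam i) 0)
  have hsplit : max (lam i) 0 - max (-lam i) 0 = lam i := by
    rcases le_total (lam i) 0 with h | h <;> simp [h]
  linear_combination (-w i ^ 2) * hpos + w i ^ 2 * hneg - w i ^ 2 * hsplit

/-- weak inhomogeneous nonlinear boundary conditions bound the
boundary term by the data. -/
theorem weak_inhomogeneous_bc_bound (n : ℕ) (hn : 0 < n)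
    (Atil T : Matrix (Fin n) (Fin n) ℝ)
    (hsym : Atil.IsSymm) (hT : IsUnit T.det)
    (lam : Fin n → ℝ) (hdiag : Tᵀ * Atil * T = Matrix.diagonal lam)
    (R S : Matrix (Fin n) (Fin n) ℝ)
    (hR : (1 - Rᵀ * R).PosDef)
    (hS : (1 - Sᵀ * S - (Rᵀ * S)ᵀ * (1 - Rᵀ * R)⁻¹ * (Rᵀ * S)).PosSemidef)
    (U G : Fin n → ℝ) :
    U ⬝ᵥ Atil.mulVec U +
      2 * (((Matrix.diagonal fun i => Real.sqrt (max (-lam i) 0)) * T⁻¹).mulVec U ⬝ᵥ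
        (((Matrix.diagonal fun i => Real.sqrt (max (-lam i) 0)) * T⁻¹
          - R * ((Matrix.diagonal fun i => Real.sqrt (max (lam i) 0)) * T⁻¹)).mulVec U
         - S.mulVec G))
    ≥ -(eNorm G ^ 2) := by
  rw [eNorm_sq, dotProduct_mulVec_eq_sub_of_congr_diagonal hT hdiag, sub_mulVec,
    ← mulVec_mulVec U R]
  set p := ((diagonal fun i => √(max (lam i) 0)) * T⁻¹) *ᵥ U
  set m := ((diagonal fun i => √(max (-lam i) 0)) * T⁻¹) *ᵥ U
  have hcontr := dotProduct_self_mulVec_add_mulVec_le hR hS p G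
  have hsq : 0 ≤ (m - (R *ᵥ p + S *ᵥ G)) ⬝ᵥ (m - (R *ᵥ p + S *ᵥ G)) :=
    Finset.sum_nonneg fun i _ => mul_self_nonneg _
  rw [sub_dotProduct, dotProduct_sub, dotProduct_sub, dotProduct_comm (R *ᵥ p + S *ᵥ G) m] at hsq
  rw [sub_sub, dotProduct_sub]
  linarith
end

section
/- Let R and S be real n×n matrices such that I − RᵀR is positive definite and I − SᵀS − (RᵀS)ᵀ(I − RᵀR)⁻¹(RᵀS) is positive semidefinite. Then for all vectors w, g ∈ ℝⁿ, ‖R w + S g‖² ≤ ‖w‖² + ‖g‖². -/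
open Matrix

/-- under the conditions on `R` and `S`,
`‖Rw + Sg‖² ≤ ‖w‖² + ‖g‖²`. -/
theorem combined_contraction_bound (n : ℕ) (hn : 0 < n)
    (R S : Matrix (Fin n) (Fin n) ℝ)
    (hR : (1 - Rᵀ * R).PosDef)
    (hS : (1 - Sᵀ * S - (Rᵀ * S)ᵀ * (1 - Rᵀ * R)⁻¹ * (Rᵀ * S)).PosSemidef)
    (w g : Fin n → ℝ) :
    eNorm (R.mulVec w + S.mulVec g) ^ 2 ≤ eNorm w ^ 2 + eNorm g ^ 2 := by
  have : Invertible (1 - Rᵀ * R) := hR.isUnit.invertible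
  have hblock := (PosDef.fromBlocks₁₁ (Rᵀ * S) (1 - Sᵀ * S) hR).mpr
    (by simpa only [conjTranspose_eq_transpose_of_trivial] using hS)
  have hform := hblock.dotProduct_mulVec_nonneg (Sum.elim (-w) g)
  simp only [star_trivial, conjTranspose_eq_transpose_of_trivial, fromBlocks_mulVec,
    Sum.elim_comp_inl, Sum.elim_comp_inr, sumElim_dotProduct_sumElim, sub_mulVec, one_mulVec,
    transpose_mul, transpose_transpose, ← mulVec_mulVec, mulVec_neg, dotProduct_add,
    dotProduct_sub, dotProduct_neg, neg_dotProduct, dotProduct_transpose_mulVec] at hform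
  simp only [eNorm_sq, add_dotProduct, dotProduct_add]
  linarith [dotProduct_comm (R *ᵥ w) (S *ᵥ g)]
end

section
/- Let P be a real symmetric n×n matrix, let A : ℝⁿ → Mₙ(ℝ) be continuously differentiable, and let C be a real n×n matrix with C + Cᵀ = 0. Suppose U : [0,1] × [0,∞) → ℝⁿ is continuously differentiable and satisfies the skew-symmetric-form equation P ∂ₜU + ∂ₓ(A(U)U) + A(U)ᵀ ∂ₓU + C U = 0 on [0,1] × [0,∞). Then for every t > 0, the energy ‖U(·,t)‖²_P = ∫₀¹ U(x,t)ᵀ P U(x,t) dx is differentiable in t and (1/2) d/dt ‖U(·,t)‖²_P = −( U(1,t)ᵀ A(U(1,t)) U(1,t) − U(0,t)ᵀ A(U(0,t)) U(0,t) ); i.e., the energy rate depends only on the boundary terms. -/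
open Matrix

attribute [local instance] Matrix.normedAddCommGroup Matrix.normedSpace

/-- Product rule for the dot product. -/
theorem HasDerivAt.dotProduct {ι : Type*} [Fintype ι] {u v : ℝ → ι → ℝ} {u' v' : ι → ℝ} {x : ℝ}
    (hu : HasDerivAt u u' x) (hv : HasDerivAt v v' x) :
    HasDerivAt (fun y => u y ⬝ᵥ v y) (u' ⬝ᵥ v x + u x ⬝ᵥ v') x := by
  rw [hasDerivAt_pi] at hu hv
  unfold _root_.dotProduct
  rw [← Finset.sum_add_distrib]
  exact HasDerivAt.fun_sum fun i _ => (hu i).fun_mul (hv i)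

theorem HasDerivAt.const_mulVec {ι κ : Type*} [Fintype ι] [Fintype κ] (M : Matrix κ ι ℝ)
    {u : ℝ → ι → ℝ} {u' : ι → ℝ} {x : ℝ} (hu : HasDerivAt u u' x) :
    HasDerivAt (fun y => M *ᵥ u y) (M *ᵥ u') x :=
  (Matrix.mulVecLin M).toContinuousLinearMap.hasFDerivAt.comp_hasDerivAt x hu

theorem ContDiff.dotProduct {E ι : Type*} [NormedAddCommGroup E] [NormedSpace ℝ E] [Fintype ι]
    {k : WithTop ℕ∞} {u v : E → ι → ℝ} (hu : ContDiff ℝ k u) (hv : ContDiff ℝ k v) :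
    ContDiff ℝ k (fun y => u y ⬝ᵥ v y) := by
  rw [contDiff_pi] at hu hv
  exact ContDiff.sum fun i _ => (hu i).mul (hv i)

theorem ContDiff.matrix_mulVec {E ι κ : Type*} [NormedAddCommGroup E] [NormedSpace ℝ E]
    [Fintype ι] [Fintype κ] {k : WithTop ℕ∞} {M : E → Matrix κ ι ℝ} {u : E → ι → ℝ}
    (hM : ContDiff ℝ k M) (hu : ContDiff ℝ k u) : ContDiff ℝ k (fun y => M y *ᵥ u y) :=
  contDiff_pi.2 fun i => (contDiff_pi.1 hM i).dotProduct hu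

/-- Differentiation under the integral sign over a compact interval for a `C¹` integrand. -/
theorem ContDiff.hasDerivAt_intervalIntegral_param {G : ℝ × ℝ → ℝ} (hG : ContDiff ℝ 1 G)
    (a b t : ℝ) :
    HasDerivAt (fun s => ∫ x in a..b, G (x, s)) (∫ x in a..b, deriv (fun s => G (x, s)) t) t := by
  have hderiv (x s : ℝ) : HasDerivAt (fun r => G (x, r)) (fderiv ℝ G (x, s) (0, 1)) s :=
    (hG.differentiable one_ne_zero (x, s)).hasFDerivAt.comp_hasDerivAt s
      ((hasDerivAt_const s x).prodMk (hasDerivAt_id s))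
  have hcont : Continuous fun p : ℝ × ℝ => fderiv ℝ G p (0, 1) :=
    (hG.continuous_fderiv one_ne_zero).clm_apply continuous_const
  obtain ⟨K, hK⟩ := (isCompact_uIcc.prod (isCompact_closedBall t 1)).exists_bound_of_continuousOn
    (s := Set.uIcc a b ×ˢ Metric.closedBall t 1) hcont.continuousOn
  simp_rw [fun x => (hderiv x t).deriv]
  refine (intervalIntegral.hasDerivAt_integral_of_dominated_loc_of_deriv_le
    (F := fun s x => G (x, s)) (F' := fun s x => fderiv ℝ G (x, s) (0, 1)) (bound := fun _ => K)
    (Metric.closedBall_mem_nhds t one_pos) ?_ ?_ ?_ ?_ ?_ ?_).2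
  · exact .of_forall fun s =>
      (hG.continuous.comp (continuous_id.prodMk continuous_const)).aestronglyMeasurable
  · exact (hG.continuous.comp (continuous_id.prodMk continuous_const)).intervalIntegrable a b
  · exact (hcont.comp (continuous_id.prodMk continuous_const)).aestronglyMeasurable
  · exact .of_forall fun x hx s hs => hK (x, s) ⟨Set.uIoc_subset_uIcc hx, hs⟩
  · exact intervalIntegrable_const
  · exact .of_forall fun x _ s _ => hderiv x s

theorem Matrix.dotProduct_mulVec_self_of_add_transpose_eq_zero {ι : Type*} [Fintype ι]
    {C : Matrix ι ι ℝ} (hC : C + Cᵀ = 0) (u : ι → ℝ) : u ⬝ᵥ C *ᵥ u = 0 := by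
  have h : u ⬝ᵥ Cᵀ *ᵥ u = u ⬝ᵥ C *ᵥ u := by
    rw [dotProduct_mulVec, vecMul_transpose, dotProduct_comm]
  have h0 : u ⬝ᵥ (C + Cᵀ) *ᵥ u = 0 := by simp [hC]
  rw [add_mulVec, dotProduct_add, h] at h0
  linarith

/-- for the 1-D inviscid skew-symmetric-form problem with
skew-symmetric `C`, the energy rate depends only on the boundary terms:
`(1/2) d/dt ‖U(·,t)‖²_P = −(UᵀA(U)U |_{x=1} − UᵀA(U)U |_{x=0})`. -/
theorem energy_rate_only_boundary_terms (n : ℕ) (hn : 0 < n)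
    (P C : Matrix (Fin n) (Fin n) ℝ) (hP : P.IsSymm) (hC : C + Cᵀ = 0)
    (A : (Fin n → ℝ) → Matrix (Fin n) (Fin n) ℝ) (hA : ContDiff ℝ 1 A)
    (U : ℝ → ℝ → (Fin n → ℝ))
    (hU : ContDiff ℝ 1 (fun p : ℝ × ℝ => U p.1 p.2))
    (heq : ∀ x ∈ Set.Icc (0 : ℝ) 1, ∀ t ≥ (0 : ℝ),
      P.mulVec (deriv (fun s => U x s) t)
        + deriv (fun y => (A (U y t)).mulVec (U y t)) x
        + (A (U x t))ᵀ.mulVec (deriv (fun y => U y t) x)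
        + C.mulVec (U x t) = 0) :
    ∀ t > (0 : ℝ), ∃ D : ℝ,
      HasDerivAt (fun s => ∫ x in (0 : ℝ)..1, U x s ⬝ᵥ P.mulVec (U x s)) D t ∧
      (1 / 2) * D =
        -(U 1 t ⬝ᵥ (A (U 1 t)).mulVec (U 1 t)
          - U 0 t ⬝ᵥ (A (U 0 t)).mulVec (U 0 t)) := by
  intro t ht
  have hUx : ContDiff ℝ 1 (fun y => U y t) := hU.comp (contDiff_id.prodMk contDiff_const)
  have hUt (x : ℝ) : ContDiff ℝ 1 (fun s => U x s) := hU.comp (contDiff_const.prodMk contDiff_id)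
  have hAU : ContDiff ℝ 1 (fun y => A (U y t) *ᵥ U y t) := (hA.comp hUx).matrix_mulVec hUx
  have hG : ContDiff ℝ 1 (fun p : ℝ × ℝ => U p.1 p.2 ⬝ᵥ P *ᵥ U p.1 p.2) :=
    hU.dotProduct (contDiff_const.matrix_mulVec hU)
  have hflux : ContDiff ℝ 1 (fun y => U y t ⬝ᵥ A (U y t) *ᵥ U y t) := hUx.dotProduct hAU
  refine ⟨_, hG.hasDerivAt_intervalIntegral_param 0 1 t, ?_⟩
  have hpt : ∀ x ∈ Set.uIcc (0 : ℝ) 1, deriv (fun s => U x s ⬝ᵥ P *ᵥ U x s) t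
      = -2 * deriv (fun y => U y t ⬝ᵥ A (U y t) *ᵥ U y t) x := by
    intro x hx
    rw [Set.uIcc_of_le zero_le_one] at hx
    have ht' := ((hUt x).differentiable one_ne_zero t).hasDerivAt
    have hx' := (hUx.differentiable one_ne_zero x).hasDerivAt
    have hAx' := (hAU.differentiable one_ne_zero x).hasDerivAt
    rw [(ht'.dotProduct (ht'.const_mulVec P)).deriv, (hx'.dotProduct hAx').deriv]
    have h := congrArg (U x t ⬝ᵥ ·) (heq x hx t ht.le)
    simp only [dotProduct_add, dotProduct_zero,
      dotProduct_mulVec_self_of_add_transpose_eq_zero hC] at h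
    have hPsymm : deriv (fun s => U x s) t ⬝ᵥ P *ᵥ U x t
        = U x t ⬝ᵥ P *ᵥ deriv (fun s => U x s) t := by
      rw [dotProduct_mulVec, dotProduct_comm, ← mulVec_transpose, hP.eq]
    have hAT : U x t ⬝ᵥ (A (U x t))ᵀ *ᵥ deriv (fun y => U y t) x
        = deriv (fun y => U y t) x ⬝ᵥ A (U x t) *ᵥ U x t := by
      rw [dotProduct_mulVec, vecMul_transpose, dotProduct_comm]
    rw [hAT] at h
    rw [hPsymm]
    linarith
  rw [intervalIntegral.integral_congr hpt, intervalIntegral.integral_const_mul,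
    intervalIntegral.integral_deriv_eq_sub (fun x _ => hflux.differentiable one_ne_zero x)
      ((hflux.continuous_deriv le_rfl).intervalIntegrable 0 1)]
  ring
end
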